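/- Let k ≤ 0, m,n ∈ ℕ, and let x ∈ A(S^7_q) ⊗_B A(S^7_q) satisfy χ(x) = 1 ⊗ r^{k,m,n}. Then χ(q^4 z_1 x z_1* + q^2 z_2* x z_2 + q^{m+n} z_3* x z_3 + q^{m+n} z_4 x z_4*) = 1 ⊗ r^{k−1,m,n}, where products are taken in the A(S^7_q)-bimodule A(S^7_q) ⊗_B A(S^7_q). -/

import Mathlib

open scoped TensorProduct

noncomputable section

namespace QIB

/-- Generators of `A(U_q(4))`: the matrix entries `t i j` and the extra generator `D_q⁻¹`. -/
abbrev genU : Type := (Fin 4 × Fin 4) ⊕ Unit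

abbrev FU : Type := FreeAlgebra ℂ genU

def T (i j : Fin 4) : FU := FreeAlgebra.ι ℂ (Sum.inl (i, j))

def Dinv0 : FU := FreeAlgebra.ι ℂ (Sum.inr ())

/-- The length (number of inversions) of a permutation of `Fin 4`. -/
def plen (σ : Equiv.Perm (Fin 4)) : ℕ :=
  ((Finset.univ : Finset (Fin 4 × Fin 4)).filter fun p => p.1 < p.2 ∧ σ p.2 < σ p.1).card

/-- The quantum determinant, as an element of the free algebra. -/
def Dq0 (q : ℝ) : FU :=
  ∑ σ : Equiv.Perm (Fin 4),
    ((-(q : ℂ)) ^ plen σ) • (T (σ 0) 0 * T (σ 1) 1 * T (σ 2) 2 * T (σ 3) 3)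

/-- The defining relations of `A(U_q(4))`. -/
inductive relU (q : ℝ) : FU → FU → Prop
  | col {i j k : Fin 4} : i < j → relU q (T i k * T j k) ((q : ℂ) • (T j k * T i k))
  | row {i j k : Fin 4} : i < j → relU q (T k i * T k j) ((q : ℂ) • (T k j * T k i))
  | comm {i j k l : Fin 4} : i < j → k < l → relU q (T i l * T j k) (T j k * T i l)
  | qcom {i j k l : Fin 4} : i < j → k < l →
      relU q (T i k * T j l - T j l * T i k) (((q : ℂ) - (q : ℂ)⁻¹) • (T j k * T i l))
  | dr : relU q (Dq0 q * Dinv0) 1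
  | dl : relU q (Dinv0 * Dq0 q) 1

variable (q : ℝ)

/-- The algebra `A(U_q(4))`. -/
abbrev AU : Type := RingQuot (relU q)

/-- The generators `t i j` of `A(U_q(4))` (indices are 0-based). -/
def tt (i j : Fin 4) : AU q := RingQuot.mkAlgHom ℂ (relU q) (T i j)

/-- The generator `D_q⁻¹`. -/
def dI : AU q := RingQuot.mkAlgHom ℂ (relU q) Dinv0

/-- The quantum determinant `D_q` in `A(U_q(4))`. -/
def Dq : AU q := RingQuot.mkAlgHom ℂ (relU q) (Dq0 q)

/-- The spanning set `R` of relation elements (0-based indices). -/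
def Rset : Set (AU q) :=
  {tt q 0 2, tt q 2 0, tt q 0 3, tt q 3 0, tt q 1 3, tt q 3 1, tt q 1 2, tt q 2 1,
   tt q 0 0 - tt q 3 3, tt q 0 1 + tt q 3 2, tt q 1 0 + tt q 2 3, tt q 1 1 - tt q 2 2,
   tt q 0 0 * tt q 1 1 - (q : ℂ) • (tt q 0 1 * tt q 1 0) - 1}

/-- The right ideal `ℛ = R · A(U_q(4))`, as a `ℂ`-submodule. -/
def RIdeal : Submodule ℂ (AU q) :=
  Submodule.span ℂ {y | ∃ x ∈ Rset q, ∃ a : AU q, y = x * a}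

/-- The coalgebra `C = A(U_q(4)) / ℛ`. -/
abbrev Cq : Type := AU q ⧸ RIdeal q

/-- The canonical projection `r : A(U_q(4)) → C`. -/
def rr : AU q →ₗ[ℂ] Cq q := (RIdeal q).mkQ

lemma RIdeal_mul_right {y : AU q} (hy : y ∈ RIdeal q) (c : AU q) : y * c ∈ RIdeal q := by
  induction hy using Submodule.span_induction with
  | mem x hx =>
      obtain ⟨x0, hx0, a, rfl⟩ := hx
      exact Submodule.subset_span ⟨x0, hx0, a * c, by rw [mul_assoc]⟩
  | zero => simp
  | add u v _ _ hu hv => simpa [add_mul] using (RIdeal q).add_mem hu hv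
  | smul a u _ hu => simpa [smul_mul_assoc] using (RIdeal q).smul_mem a hu

/-- Auxiliary map for the right `A(U_q(4))`-module structure of `C`:
right multiplication by `c` descends to the quotient. -/
def cactAux (c : AU q) : Cq q →ₗ[ℂ] Cq q :=
  Submodule.liftQ (RIdeal q) ((RIdeal q).mkQ ∘ₗ LinearMap.mulRight ℂ c)
    (by
      intro y hy
      simp only [LinearMap.mem_ker, LinearMap.comp_apply, LinearMap.mulRight_apply,
        Submodule.mkQ_apply, Submodule.Quotient.mk_eq_zero]
      exact RIdeal_mul_right q hy c)

@[simp] lemma cactAux_mk (c a : AU q) :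
    cactAux q c (Submodule.Quotient.mk a) = (Submodule.Quotient.mk (a * c) : Cq q) := by
  simp [cactAux]

/-- The right `A(U_q(4))`-module structure `r(t) · t' := r(t t')` of `C`,
as a bilinear map `A(U_q(4)) →ₗ C →ₗ C`, `(c, x) ↦ x · c`. -/
def cact : AU q →ₗ[ℂ] Cq q →ₗ[ℂ] Cq q where
  toFun c := cactAux q c
  map_add' c c' := by
    refine LinearMap.ext fun x => ?_
    obtain ⟨a, rfl⟩ := Submodule.Quotient.mk_surjective _ x
    simp only [cactAux_mk, mul_add, Submodule.Quotient.mk_add, LinearMap.add_apply]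
  map_smul' s c := by
    refine LinearMap.ext fun x => ?_
    obtain ⟨a, rfl⟩ := Submodule.Quotient.mk_surjective _ x
    simp only [cactAux_mk, mul_smul_comm, Submodule.Quotient.mk_smul, RingHom.id_apply, LinearMap.smul_apply]

@[simp] lemma cact_mk (c a : AU q) : cact q c (rr q a) = rr q (a * c) := by
  simp [cact, rr]

/-- θ(k) = 1 for k ≥ 0 and 0 for k < 0. -/
def thetaZ (k : ℤ) : ℂ := if 0 ≤ k then 1 else 0

/-- The linear basis elements `r^{k,m,n}` of `C`, given as representatives in `A(U_q(4))`. -/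
def bas (k : ℤ) (m n : ℕ) : AU q :=
  if 0 ≤ k then tt q 0 0 ^ k.toNat * tt q 0 1 ^ m * tt q 1 0 ^ n
  else tt q 0 1 ^ m * tt q 1 0 ^ n * tt q 1 1 ^ (-k).toNat

/-! ### The quantum seven-sphere -/

/-- Generators of `A(S⁷_q)`: `(i, false)` is `z_i`, `(i, true)` is `z_i^*`. -/
abbrev genS : Type := Fin 4 × Bool

abbrev FS : Type := FreeAlgebra ℂ genS

def Z0 (i : Fin 4) : FS := FreeAlgebra.ι ℂ (i, false)

def Zs0 (i : Fin 4) : FS := FreeAlgebra.ι ℂ (i, true)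

/-- The defining relations of the ∗-algebra `A(S⁷_q)` (including the ∗-conjugate of the
first family of relations, so that the relation set is closed under the involution). -/
inductive relS (q : ℝ) : FS → FS → Prop
  | zz {i j : Fin 4} : i < j → relS q (Z0 i * Z0 j) ((q : ℂ) • (Z0 j * Z0 i))
  | ss {i j : Fin 4} : i < j → relS q (Zs0 j * Zs0 i) ((q : ℂ) • (Zs0 i * Zs0 j))
  | sz {i j : Fin 4} : i ≠ j → relS q (Zs0 j * Z0 i) ((q : ℂ) • (Z0 i * Zs0 j))
  | szz {k : Fin 4} : relS q (Zs0 k * Z0 k)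
      (Z0 k * Zs0 k + (1 - (q : ℂ) ^ 2) •
        ∑ j ∈ Finset.univ.filter (· < k), Z0 j * Zs0 j)
  | sum1 : relS q (∑ k : Fin 4, Z0 k * Zs0 k) 1

/-- The algebra `P = A(S⁷_q)`. -/
abbrev PA : Type := RingQuot (relS q)

/-- The generators `z_i` of `A(S⁷_q)` (0-based index). -/
def z (i : Fin 4) : PA q := RingQuot.mkAlgHom ℂ (relS q) (Z0 i)

/-- The generators `z_i^*` of `A(S⁷_q)` (0-based index). -/
def zs (i : Fin 4) : PA q := RingQuot.mkAlgHom ℂ (relS q) (Zs0 i)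

/-- The element `R = z₁ z₁^* + z₂ z₂^*` of `A(S⁷_q)`. -/
def RRe [StarRing (PA q)] : PA q := z q 0 * star (z q 0) + z q 1 * star (z q 1)

/-- The element `a = z₁ z₄^* − z₂ z₃^*` of `A(S⁷_q)`. -/
def aa [StarRing (PA q)] : PA q := z q 0 * star (z q 3) - z q 1 * star (z q 2)

/-- The element `b = z₁ z₃ + q⁻¹ z₂ z₄` of `A(S⁷_q)`. -/
def bb : PA q := z q 0 * z q 2 + (q : ℂ)⁻¹ • (z q 1 * z q 3)

/-- The elements `a_n = z₁ z₄^* − qⁿ z₂ z₃^*` of `A(S⁷_q)`. -/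
def aN [StarRing (PA q)] (n : ℤ) : PA q :=
  z q 0 * star (z q 3) - ((q : ℂ) ^ n) • (z q 1 * star (z q 2))

/-- The elements `b_n = z₁ z₃ + q^{n−1} z₂ z₄` of `A(S⁷_q)`. -/
def bN (n : ℤ) : PA q := z q 0 * z q 2 + ((q : ℂ) ^ (n - 1)) • (z q 1 * z q 3)

/-! ### The coaction, the coinvariants and the canonical map -/

variable (δ : PA q →ₐ[ℂ] PA q ⊗[ℂ] AU q)

/-- `Δ_r := (id ⊗ r) ∘ Δ : A(S⁷_q) → A(S⁷_q) ⊗ C`, built from the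
`A(U_q(4))`-coaction `δ`. -/
def Dr : PA q →ₗ[ℂ] PA q ⊗[ℂ] Cq q :=
  (LinearMap.lTensor (PA q) (rr q)) ∘ₗ δ.toLinearMap

/-- The set of coinvariants `B = A(Σ⁴_q) = {a | Δ_r(a) = a ⊗ r(1)}`. -/
def Bset : Set (PA q) := {a : PA q | Dr q δ a = a ⊗ₜ[ℂ] rr q 1}

/-- The subspace of `P ⊗ P` spanned by the elements `(u b) ⊗ v − u ⊗ (b v)` with `b`
a coinvariant; quotienting by it produces the balanced tensor product `P ⊗_B P`. -/
def relT : Submodule ℂ (PA q ⊗[ℂ] PA q) :=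
  Submodule.span ℂ
    {x : PA q ⊗[ℂ] PA q | ∃ u v b : PA q, b ∈ Bset q δ ∧
      x = (u * b) ⊗ₜ[ℂ] v - u ⊗ₜ[ℂ] (b * v)}

instance instAddCommGroupPP : AddCommGroup (PA q ⊗[ℂ] PA q) := TensorProduct.addCommGroup

/-- The balanced tensor product `P ⊗_B P` over the coinvariant subalgebra `B = A(Σ⁴_q)`. -/
abbrev PBP : Type := (PA q ⊗[ℂ] PA q) ⧸ relT q δ

/-- The canonical projection `P ⊗ P → P ⊗_B P`. -/
def mkT : PA q ⊗[ℂ] PA q →ₗ[ℂ] PBP q δ := (relT q δ).mkQ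

lemma relT_map_lmul (p : PA q) {x : PA q ⊗[ℂ] PA q} (hx : x ∈ relT q δ) :
    TensorProduct.map (LinearMap.mulLeft ℂ p) LinearMap.id x ∈ relT q δ := by
  induction hx using Submodule.span_induction with
  | mem y hy =>
      obtain ⟨u, v, b, hb, rfl⟩ := hy
      refine Submodule.subset_span ⟨p * u, v, b, hb, ?_⟩
      simp [TensorProduct.map_tmul, mul_assoc]
  | zero => simp
  | add u v _ _ hu hv => simpa [map_add] using Submodule.add_mem _ hu hv
  | smul a u _ hu => simpa [map_smul] using Submodule.smul_mem _ a hu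

lemma relT_map_rmul (p : PA q) {x : PA q ⊗[ℂ] PA q} (hx : x ∈ relT q δ) :
    TensorProduct.map LinearMap.id (LinearMap.mulRight ℂ p) x ∈ relT q δ := by
  induction hx using Submodule.span_induction with
  | mem y hy =>
      obtain ⟨u, v, b, hb, rfl⟩ := hy
      refine Submodule.subset_span ⟨u, v * p, b, hb, ?_⟩
      simp [TensorProduct.map_tmul, mul_assoc]
  | zero => simp
  | add u v _ _ hu hv => simpa [map_add] using Submodule.add_mem _ hu hv
  | smul a u _ hu => simpa [map_smul] using Submodule.smul_mem _ a hu

/-- Left multiplication by `p ∈ P` on the bimodule `P ⊗_B P`. -/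
def lact (p : PA q) : PBP q δ →ₗ[ℂ] PBP q δ :=
  Submodule.liftQ (relT q δ)
    ((relT q δ).mkQ ∘ₗ TensorProduct.map (LinearMap.mulLeft ℂ p) LinearMap.id)
    (by
      intro x hx
      simp only [LinearMap.mem_ker, LinearMap.comp_apply, Submodule.mkQ_apply,
        Submodule.Quotient.mk_eq_zero]
      exact relT_map_lmul q δ p hx)

/-- Right multiplication by `p ∈ P` on the bimodule `P ⊗_B P`. -/
def ract (p : PA q) : PBP q δ →ₗ[ℂ] PBP q δ :=
  Submodule.liftQ (relT q δ)
    ((relT q δ).mkQ ∘ₗ TensorProduct.map LinearMap.id (LinearMap.mulRight ℂ p))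
    (by
      intro x hx
      simp only [LinearMap.mem_ker, LinearMap.comp_apply, Submodule.mkQ_apply,
        Submodule.Quotient.mk_eq_zero]
      exact relT_map_rmul q δ p hx)

/-- The structure map of the right action `◁` of `A(S⁷_q)` on `A(S⁷_q) ⊗ C`:
on simple tensors, `(u ⊗ x) ⊗ (w ⊗ y) ↦ (u w) ⊗ (x · y)`.  The action is
`(u ⊗ x) ◁ v = triMap ((u ⊗ x) ⊗ δ v) = Σ u v₍₀₎ ⊗ x · v₍₁₎`. -/
def triMap : (PA q ⊗[ℂ] Cq q) ⊗[ℂ] (PA q ⊗[ℂ] AU q) →ₗ[ℂ] PA q ⊗[ℂ] Cq q :=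
  (TensorProduct.map (LinearMap.mul' ℂ (PA q)) (TensorProduct.lift (LinearMap.flip (cact q)))) ∘ₗ
    (TensorProduct.tensorTensorTensorComm ℂ (PA q) (Cq q) (PA q) (AU q)).toLinearMap

/-! ### Helper material -/

lemma tt_col {i j : Fin 4} (k : Fin 4) (h : i < j) :
    tt q i k * tt q j k = (q : ℂ) • (tt q j k * tt q i k) := by
  have e := RingQuot.mkAlgHom_rel ℂ (relU.col (q := q) (k := k) h)
  simp only [map_mul, map_smul] at e
  exact e

lemma tt_row {i j : Fin 4} (k : Fin 4) (h : i < j) :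
    tt q k i * tt q k j = (q : ℂ) • (tt q k j * tt q k i) := by
  have e := RingQuot.mkAlgHom_rel ℂ (relU.row (q := q) (k := k) h)
  simp only [map_mul, map_smul] at e
  exact e

lemma tt_comm {i j k l : Fin 4} (h : i < j) (h' : k < l) :
    tt q i l * tt q j k = tt q j k * tt q i l := by
  simpa [tt] using RingQuot.mkAlgHom_rel ℂ (relU.comm (q := q) h h')

lemma tt_qcom {i j k l : Fin 4} (h : i < j) (h' : k < l) :
    tt q i k * tt q j l - tt q j l * tt q i k
      = ((q : ℂ) - (q : ℂ)⁻¹) • (tt q j k * tt q i l) := by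
  simpa [tt] using RingQuot.mkAlgHom_rel ℂ (relU.qcom (q := q) h h')

lemma zs_z {i j : Fin 4} (h : i ≠ j) : zs q j * z q i = (q : ℂ) • (z q i * zs q j) := by
  have e := RingQuot.mkAlgHom_rel ℂ (relS.sz (q := q) h)
  simp only [map_mul, map_smul] at e
  exact e

lemma zs_z_self (k : Fin 4) : zs q k * z q k = z q k * zs q k + (1 - (q : ℂ) ^ 2) •
        ∑ j ∈ Finset.univ.filter (· < k), z q j * zs q j := by
  simpa [z, zs] using RingQuot.mkAlgHom_rel ℂ (relS.szz (q := q) (k := k))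

lemma z_zs_sum : ∑ k : Fin 4, z q k * zs q k = 1 := by
  simpa [z, zs] using RingQuot.mkAlgHom_rel ℂ (relS.sum1 (q := q))

lemma gen_comm_split {A : Type*} [Ring A] (w v t : A) :
    w * v * t - t * (w * v) = w * (v * t - t * v) + (w * t - t * w) * v := by
  noncomm_ring

lemma gen_sub_one {A : Type*} [Ring A] (w t : A) : w * t - t = (w - 1) * t := by
  noncomm_ring

lemma gen_det {A : Type*} [Ring A] [Algebra ℂ A] {a b c d : A} {s : ℂ}
    (e : a * d - d * a = (s - s⁻¹) • (c * b)) (e' : b * c = c * b) :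
    a * d - s • (b * c) = d * a - s⁻¹ • (b * c) := by
  rw [sub_eq_iff_eq_add.1 e, e', sub_smul]
  abel

/-- Indices outside the two diagonal blocks. -/
def off (i j : Fin 4) : Prop := (i < 2 ∧ 2 ≤ j) ∨ (2 ≤ i ∧ j < 2)

/-- The right ideal generated by the entries outside the diagonal blocks. -/
def VV : Submodule ℂ (AU q) :=
  Submodule.span ℂ {y | ∃ i j : Fin 4, ∃ a : AU q, off i j ∧ y = tt q i j * a}

variable {q}

lemma VV_gen {i j : Fin 4} (h : off i j) (a : AU q) : tt q i j * a ∈ VV q :=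
  Submodule.subset_span ⟨i, j, a, h, rfl⟩

lemma VV_mul_right {y : AU q} (hy : y ∈ VV q) (c : AU q) : y * c ∈ VV q := by
  induction hy using Submodule.span_induction with
  | mem x hx =>
      obtain ⟨i, j, a, h, rfl⟩ := hx
      rw [mul_assoc]; exact VV_gen h _
  | zero => simp
  | add u v _ _ hu hv => simpa [add_mul] using (VV q).add_mem hu hv
  | smul a u _ hu => simpa [smul_mul_assoc] using (VV q).smul_mem a hu

lemma RI_gen {x : AU q} (h : x ∈ Rset q) (a : AU q) : x * a ∈ RIdeal q :=
  Submodule.subset_span ⟨x, h, a, rfl⟩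

lemma VV_le : VV q ≤ RIdeal q := by
  refine Submodule.span_le.2 ?_
  rintro _ ⟨i, j, a, h, rfl⟩
  refine RI_gen ?_ a
  fin_cases i <;> fin_cases j <;> simp [off] at h <;> simp [Rset]

lemma VV_gen_mul {g h : Fin 4} (hg : g < 2) (hh : h < 2) {i j : Fin 4} (ho : off i j) (a : AU q) :
    tt q g h * (tt q i j * a) ∈ VV q := by
  rw [← mul_assoc]
  refine VV_mul_right ?_ a
  rcases ho with ⟨hi, hj⟩ | ⟨hi, hj⟩
  · have hhj : h < j := lt_of_lt_of_le hh hj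
    rcases lt_trichotomy g i with hgi | rfl | hgi
    · have e := tt_qcom q hgi hhj
      rw [sub_eq_iff_eq_add.1 e, ← tt_comm q hgi hhj]
      exact add_mem ((VV q).smul_mem _ (VV_gen (Or.inl ⟨hg, hj⟩) _)) (VV_gen (Or.inl ⟨hi, hj⟩) _)
    · rw [tt_row q g hhj]
      exact (VV q).smul_mem _ (VV_gen (Or.inl ⟨hg, hj⟩) _)
    · rw [← tt_comm q hgi hhj]
      exact VV_gen (Or.inl ⟨hi, hj⟩) _
  · have hgi : g < i := lt_of_lt_of_le hg hi
    rcases lt_trichotomy h j with hhj | rfl | hhj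
    · have e := tt_qcom q hgi hhj
      rw [sub_eq_iff_eq_add.1 e]
      exact add_mem ((VV q).smul_mem _ (VV_gen (Or.inr ⟨hi, hh⟩) _)) (VV_gen (Or.inr ⟨hi, hj⟩) _)
    · rw [tt_col q h hgi]
      exact (VV q).smul_mem _ (VV_gen (Or.inr ⟨hi, hh⟩) _)
    · rw [tt_comm q hgi hhj]
      exact VV_gen (Or.inr ⟨hi, hj⟩) _

/-- Elements that preserve `VV` from the left and commute with the lower block modulo `VV`. -/
def good (w : AU q) : Prop :=
  (∀ y ∈ VV q, w * y ∈ VV q) ∧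
    ∀ i j : Fin 4, 2 ≤ i → 2 ≤ j → w * tt q i j - tt q i j * w ∈ VV q

lemma good_one : good (1 : AU q) := ⟨fun y hy => by simpa using hy, fun i j _ _ => by simp⟩

lemma good_mul {w w' : AU q} (h : good w) (h' : good w') : good (w * w') := by
  refine ⟨fun y hy => by rw [mul_assoc]; exact h.1 _ (h'.1 _ hy), fun i j hi hj => ?_⟩
  rw [gen_comm_split]
  exact add_mem (h.1 _ (h'.2 i j hi hj)) (VV_mul_right (h.2 i j hi hj) _)

lemma good_pow {w : AU q} (h : good w) (n : ℕ) : good (w ^ n) := by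
  induction n with
  | zero => simpa using good_one
  | succ n ih => rw [pow_succ]; exact good_mul ih h

lemma good_tt {g h : Fin 4} (hg : g < 2) (hh : h < 2) : good (tt q g h) := by
  refine ⟨fun y hy => ?_, fun i j hi hj => ?_⟩
  · induction hy using Submodule.span_induction with
    | mem x hx =>
        obtain ⟨i, j, a, ho, rfl⟩ := hx
        exact VV_gen_mul hg hh ho a
    | zero => simp
    | add u v _ _ hu hv => simpa [mul_add] using (VV q).add_mem hu hv
    | smul a u _ hu => simpa [mul_smul_comm] using (VV q).smul_mem a hu
  · rw [tt_qcom q (lt_of_lt_of_le hg hi) (lt_of_lt_of_le hh hj)]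
    exact (VV q).smul_mem _ (VV_gen (Or.inr ⟨hi, hh⟩) _)

lemma rr_eq {a b : AU q} (h : a - b ∈ RIdeal q) : rr q a = rr q b :=
  (Submodule.Quotient.eq _).2 h

lemma rr_off {w : AU q} (hw : good w) {i j : Fin 4} (h : off i j) (a : AU q) :
    rr q (w * (tt q i j * a)) = 0 :=
  (Submodule.Quotient.mk_eq_zero _).2 (VV_le (hw.1 _ (VV_gen h a)))

lemma rr_off' {w : AU q} (hw : good w) {i j : Fin 4} (h : off i j) :
    rr q (w * tt q i j) = 0 := by
  simpa using rr_off hw h 1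

lemma rr_low {w : AU q} (hw : good w) {i j : Fin 4} (hi : 2 ≤ i) (hj : 2 ≤ j) (a : AU q) :
    rr q (w * (tt q i j * a)) = rr q (tt q i j * (w * a)) := by
  refine rr_eq (VV_le ?_)
  have := VV_mul_right (hw.2 i j hi hj) a
  simpa [sub_mul, mul_assoc] using this

lemma rr_33 (a : AU q) : rr q (tt q 2 2 * a) = rr q (tt q 1 1 * a) := by
  symm
  refine rr_eq ?_
  rw [← sub_mul]; exact RI_gen (by simp [Rset]) a

lemma rr_44 (a : AU q) : rr q (tt q 3 3 * a) = rr q (tt q 0 0 * a) := by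
  symm
  refine rr_eq ?_
  rw [← sub_mul]; exact RI_gen (by simp [Rset]) a

lemma rr_43 (a : AU q) : rr q (tt q 3 2 * a) = - rr q (tt q 0 1 * a) := by
  rw [← map_neg]
  refine rr_eq ?_
  rw [sub_neg_eq_add, ← add_mul, add_comm]; exact RI_gen (by simp [Rset]) a

lemma rr_34 (a : AU q) : rr q (tt q 2 3 * a) = - rr q (tt q 1 0 * a) := by
  rw [← map_neg]
  refine rr_eq ?_
  rw [sub_neg_eq_add, ← add_mul, add_comm]; exact RI_gen (by simp [Rset]) a

variable (q) in
/-- The quantum determinant of the upper block. -/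
def dd : AU q := tt q 0 0 * tt q 1 1 - (q : ℂ) • (tt q 0 1 * tt q 1 0)

lemma rr_dd (a : AU q) : rr q (dd q * a) = rr q a := by
  refine rr_eq ?_
  rw [gen_sub_one]; exact RI_gen (by simp [Rset, dd]) a

variable (q) in
/-- The representative of `r^{-K,m,n}`. -/
def bb' (K m n : ℕ) : AU q := tt q 0 1 ^ m * tt q 1 0 ^ n * tt q 1 1 ^ K

lemma good_bb (K m n : ℕ) : good (bb' q K m n) :=
  good_mul (good_mul (good_pow (good_tt (by decide) (by decide)) _)
    (good_pow (good_tt (by decide) (by decide)) _)) (good_pow (good_tt (by decide) (by decide)) _)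

lemma qpow_comm {A : Type*} [Ring A] [Algebra ℂ A] {c : ℂ} {x y : A} (h : x * y = c • (y * x))
    (n : ℕ) : x ^ n * y = c ^ n • (y * x ^ n) := by
  induction n with
  | zero => simp
  | succ n ih =>
      rw [pow_succ, mul_assoc, h, mul_smul_comm, ← mul_assoc, ih, smul_mul_assoc, smul_smul,
        mul_assoc, pow_succ, mul_comm c]

lemma qpow_comm' {A : Type*} [Ring A] [Algebra ℂ A] {c : ℂ} {x y : A} (h : x * y = c • (y * x))
    (n : ℕ) : x * y ^ n = c ^ n • (y ^ n * x) := by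
  induction n with
  | zero => simp
  | succ n ih =>
      rw [pow_succ, ← mul_assoc, ih, smul_mul_assoc, mul_assoc, h, mul_smul_comm, smul_smul,
        ← mul_assoc, pow_succ]

lemma bb_22 (K m n : ℕ) :
    bb' q K m n * tt q 1 1 = (q : ℂ) ^ (m + n) • (tt q 1 1 * bb' q K m n) := by
  have h1 := qpow_comm (tt_col q (i := 0) (j := 1) 1 (by decide)) m
  have h2 := qpow_comm (tt_row q (i := 0) (j := 1) 1 (by decide)) n
  have h3 : tt q 1 1 ^ K * tt q 1 1 = tt q 1 1 * tt q 1 1 ^ K := (pow_mul_comm' _ _)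
  simp only [bb']
  rw [mul_assoc, h3, ← mul_assoc, mul_assoc (tt q 0 1 ^ m), h2, mul_smul_comm, smul_mul_assoc,
    ← mul_assoc, h1, smul_mul_assoc, smul_mul_assoc, smul_smul]
  simp only [mul_assoc, pow_add, mul_comm]

lemma bb_12 (K m n : ℕ) :
    tt q 0 1 * bb' q K m n = (q : ℂ) ^ K • (bb' q K m n * tt q 0 1) := by
  have h1 := qpow_comm' (tt_col q (i := 0) (j := 1) 1 (by decide)) K
  have h2 : Commute (tt q 0 1) (tt q 0 1 ^ m * tt q 1 0 ^ n) :=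
    ((Commute.refl _).pow_right m).mul_right
      (Commute.pow_right (tt_comm q (i := 0) (j := 1) (k := 0) (l := 1) (by decide) (by decide)) n)
  simp only [bb']
  rw [← mul_assoc, h2.eq, mul_assoc, h1, mul_smul_comm, ← mul_assoc]

lemma dd_eq (hq : (q : ℂ) ≠ 0) :
    dd q = tt q 1 1 * tt q 0 0 - (q : ℂ)⁻¹ • (tt q 0 1 * tt q 1 0) := by
  have e := tt_qcom q (i := 0) (j := 1) (k := 0) (l := 1) (by decide) (by decide)
  have e' := tt_comm q (i := 0) (j := 1) (k := 0) (l := 1) (by decide) (by decide)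
  exact gen_det e e'

lemma dd_comm_12 (hq : (q : ℂ) ≠ 0) : Commute (dd q) (tt q 0 1) := by
  have h1 : tt q 0 1 * tt q 1 1 = (q : ℂ) • (tt q 1 1 * tt q 0 1) := tt_col q 1 (by decide)
  have h2 : tt q 0 0 * tt q 0 1 = (q : ℂ) • (tt q 0 1 * tt q 0 0) := tt_row q 0 (by decide)
  have h3 : tt q 0 1 * tt q 1 0 = tt q 1 0 * tt q 0 1 := tt_comm q (by decide) (by decide)
  have h1' : tt q 1 1 * tt q 0 1 = (q : ℂ)⁻¹ • (tt q 0 1 * tt q 1 1) := by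
    rw [h1, smul_smul, inv_mul_cancel₀ hq, one_smul]
  unfold Commute SemiconjBy dd
  rw [sub_mul, mul_sub, mul_assoc, h1', mul_smul_comm, ← mul_assoc, h2, smul_mul_assoc, smul_smul,
    inv_mul_cancel₀ hq, one_smul, smul_mul_assoc, mul_smul_comm, mul_assoc, mul_assoc, h3]

lemma dd_comm_21 (hq : (q : ℂ) ≠ 0) : Commute (dd q) (tt q 1 0) := by
  have h1 : tt q 1 0 * tt q 1 1 = (q : ℂ) • (tt q 1 1 * tt q 1 0) := tt_row q 1 (by decide)
  have h2 : tt q 0 0 * tt q 1 0 = (q : ℂ) • (tt q 1 0 * tt q 0 0) := tt_col q 0 (by decide)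
  have h3 : tt q 0 1 * tt q 1 0 = tt q 1 0 * tt q 0 1 := tt_comm q (by decide) (by decide)
  have h1' : tt q 1 1 * tt q 1 0 = (q : ℂ)⁻¹ • (tt q 1 0 * tt q 1 1) := by
    rw [h1, smul_smul, inv_mul_cancel₀ hq, one_smul]
  unfold Commute SemiconjBy dd
  rw [sub_mul, mul_sub, mul_assoc, h1', mul_smul_comm, ← mul_assoc, h2, smul_mul_assoc, smul_smul,
    inv_mul_cancel₀ hq, one_smul, smul_mul_assoc, mul_smul_comm, h3, mul_assoc, mul_assoc, h3]

lemma dd_comm_22 (hq : (q : ℂ) ≠ 0) : Commute (dd q) (tt q 1 1) := by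
  have h1 : tt q 1 0 * tt q 1 1 = (q : ℂ) • (tt q 1 1 * tt q 1 0) := tt_row q 1 (by decide)
  have h2 : tt q 0 1 * tt q 1 1 = (q : ℂ) • (tt q 1 1 * tt q 0 1) := tt_col q 1 (by decide)
  unfold Commute SemiconjBy
  conv_lhs => rw [dd_eq hq]
  rw [dd, sub_mul, mul_sub, smul_mul_assoc, mul_assoc (tt q 0 1), h1, mul_smul_comm, smul_smul,
    inv_mul_cancel₀ hq, one_smul, ← mul_assoc, h2, smul_mul_assoc, mul_smul_comm, mul_assoc,
    mul_assoc]

lemma dd_comm_bb (hq : (q : ℂ) ≠ 0) (K m n : ℕ) : Commute (dd q) (bb' q K m n) :=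
  (((dd_comm_12 hq).pow_right m).mul_right ((dd_comm_21 hq).pow_right n)).mul_right
    ((dd_comm_22 hq).pow_right K)

lemma rr_mul {a b : AU q} (h : rr q a = rr q b) (c : AU q) : rr q (a * c) = rr q (b * c) := by
  rw [← cact_mk, h, cact_mk]

lemma rr_S (S : AU q →ₗ[ℂ] AU q)
    (hSright : ∀ i j : Fin 4, ∑ k : Fin 4, tt q i k * S (tt q k j) = if i = j then 1 else 0)
    (a : Fin 4 → AU q) (b : AU q) (j : Fin 4)
    (h : ∀ j', rr q (∑ i, a i * tt q i j') = if j = j' then rr q b else 0) (l : Fin 4) :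
    rr q (b * S (tt q j l)) = rr q (a l) := by
  have e : a l = ∑ j', (∑ i, a i * tt q i j') * S (tt q j' l) := by
    simp only [Finset.sum_mul, mul_assoc]
    rw [Finset.sum_comm]
    simp only [← Finset.mul_sum, hSright]
    simp
  rw [e, map_sum, Finset.sum_eq_single j]
  · exact (rr_mul (by simpa using h j) _).symm
  · intro j' _ hj'
    have h0 : rr q (∑ i, a i * tt q i j') = rr q 0 := by
      rw [h j', if_neg (Ne.symm hj'), map_zero]
    rw [rr_mul h0, zero_mul, map_zero]
  · simp

lemma rr_S1 (hq : (q : ℂ) ≠ 0) (S : AU q →ₗ[ℂ] AU q)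
    (hSright : ∀ i j : Fin 4, ∑ k : Fin 4, tt q i k * S (tt q k j) = if i = j then 1 else 0)
    (K m n : ℕ) (l : Fin 4) :
    rr q (bb' q K m n * S (tt q 0 l)) =
      rr q ((![bb' q K m n * tt q 1 1, (-(q : ℂ)⁻¹) • (bb' q K m n * tt q 0 1), 0, 0] :
        Fin 4 → AU q) l) := by
  refine rr_S S hSright _ _ 0 (fun j' => ?_) l
  have g := good_bb (q := q) K m n
  have g1 : good (bb' q K m n * tt q 1 1) := good_mul g (good_tt (by decide) (by decide))
  have g2 : good (bb' q K m n * tt q 0 1) := good_mul g (good_tt (by decide) (by decide))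
  simp only [Fin.sum_univ_four, Matrix.cons_val, zero_mul, add_zero, smul_mul_assoc]
  fin_cases j'
  · simp only [Fin.zero_eta, Fin.isValue, if_true]
    rw [← rr_dd (bb' q K m n), (dd_comm_bb hq K m n).eq, dd_eq hq, mul_sub, mul_smul_comm, map_add,
      map_sub, map_smul, map_smul, mul_assoc, mul_assoc, neg_smul, sub_eq_add_neg]
  · have h1 : tt q 0 1 * tt q 1 1 = (q : ℂ) • (tt q 1 1 * tt q 0 1) := tt_col q 1 (by decide)
    simp only [Fin.mk_one, map_add, map_smul, mul_assoc, h1, mul_smul_comm, smul_smul, neg_mul,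
      inv_mul_cancel₀ hq, neg_smul, one_smul, add_neg_cancel]
    simp
  · simp only [Fin.reduceFinMk, map_add, map_smul]
    rw [rr_off' g1 (by simp [off]), rr_off' g2 (by simp [off])]
    simp
  · simp only [Fin.reduceFinMk, map_add, map_smul]
    rw [rr_off' g1 (by simp [off]), rr_off' g2 (by simp [off])]
    simp

lemma rr_S4 (S : AU q →ₗ[ℂ] AU q)
    (hSright : ∀ i j : Fin 4, ∑ k : Fin 4, tt q i k * S (tt q k j) = if i = j then 1 else 0)
    (K m n : ℕ) (l : Fin 4) :
    rr q (bb' q K m n * S (tt q 3 l)) =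
      rr q ((![0, 0, (-(q : ℂ)) • (bb' q K m n * tt q 3 2), bb' q K m n * tt q 2 2] :
        Fin 4 → AU q) l) := by
  refine rr_S S hSright _ _ 3 (fun j' => ?_) l
  have g := good_bb (q := q) K m n
  have g1 : good (tt q 1 1 * bb' q K m n) := good_mul (good_tt (by decide) (by decide)) g
  have g2 : good (tt q 0 1 * bb' q K m n) := good_mul (good_tt (by decide) (by decide)) g
  have k1 : ∀ a, rr q (bb' q K m n * (tt q 2 2 * a)) = rr q (tt q 1 1 * bb' q K m n * a) :=
    fun a => by rw [rr_low g (by decide) (by decide), rr_33, mul_assoc]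
  have k2 : ∀ a, rr q (bb' q K m n * (tt q 3 2 * a)) = - rr q (tt q 0 1 * bb' q K m n * a) :=
    fun a => by rw [rr_low g (by decide) (by decide), rr_43, mul_assoc]
  have l1 := rr_low g1 (i := 3) (j := 3) (by decide) (by decide) 1
  have l2 := rr_low g2 (i := 2) (j := 3) (by decide) (by decide) 1
  simp only [mul_one] at l1 l2
  simp only [Fin.sum_univ_four, Matrix.cons_val, zero_mul, zero_add, smul_mul_assoc]
  fin_cases j'
  · simp only [Fin.zero_eta, map_add, map_smul, mul_assoc]
    rw [k1, k2, rr_off' g1 (by simp [off]), rr_off' g2 (by simp [off])]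
    simp
  · simp only [Fin.mk_one, map_add, map_smul, mul_assoc]
    rw [k1, k2, rr_off' g1 (by simp [off]), rr_off' g2 (by simp [off])]
    simp
  · have h1 : tt q 2 2 * tt q 3 2 = (q : ℂ) • (tt q 3 2 * tt q 2 2) := tt_col q 2 (by decide)
    simp only [Fin.reduceFinMk, map_add, map_smul, mul_assoc, h1, mul_smul_comm, neg_smul,
      neg_add_cancel]
    simp
  · simp only [Fin.reduceFinMk, map_add, map_smul, mul_assoc, if_true]
    rw [k1, k2, l1, l2, rr_44, rr_34]
    have h3 : tt q 0 1 * tt q 1 0 = tt q 1 0 * tt q 0 1 := tt_comm q (by decide) (by decide)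
    rw [← rr_dd (bb' q K m n), dd, sub_mul, smul_mul_assoc, h3, map_sub, map_smul, mul_assoc,
      mul_assoc]
    simp only [smul_neg, neg_smul, neg_neg]
    abel

/-- Compatibility of `χ` with the right action. -/
lemma chi_ract (δ : PA q →ₐ[ℂ] PA q ⊗[ℂ] AU q) (chi : PBP q δ →ₗ[ℂ] PA q ⊗[ℂ] Cq q)
    (hchi : ∀ p' p : PA q, chi (mkT q δ (p' ⊗ₜ[ℂ] p)) =
      TensorProduct.map (LinearMap.mulLeft ℂ p') LinearMap.id (Dr q δ p))
    (v : PA q) (x : PBP q δ) :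
    chi (ract q δ v x) = triMap q (chi x ⊗ₜ δ v) := by
  obtain ⟨y, rfl⟩ := Submodule.mkQ_surjective _ x
  change chi (ract q δ v (mkT q δ y)) = triMap q (chi (mkT q δ y) ⊗ₜ δ v)
  induction y with
  | zero => simp
  | add a b ha hb => simp only [map_add, TensorProduct.add_tmul, ha, hb]
  | tmul p' p =>
    have e : ract q δ v (mkT q δ (p' ⊗ₜ p)) = mkT q δ (p' ⊗ₜ (p * v)) := by
      simp [ract, mkT]
    rw [e, hchi, hchi]
    simp only [Dr, LinearMap.comp_apply, AlgHom.toLinearMap_apply, map_mul]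
    generalize δ p = s
    generalize δ v = t
    induction s with
    | zero => simp
    | add a b ha hb => simp only [map_add, add_mul, TensorProduct.add_tmul, ha, hb]
    | tmul u c =>
      induction t with
      | zero => simp
      | add a b ha hb => simp only [map_add, mul_add, TensorProduct.tmul_add, ha, hb]
      | tmul u' c' => simp [triMap, mul_assoc]

/-- Compatibility of `χ` with the left action. -/
lemma chi_lact (δ : PA q →ₐ[ℂ] PA q ⊗[ℂ] AU q) (chi : PBP q δ →ₗ[ℂ] PA q ⊗[ℂ] Cq q)
    (hchi : ∀ p' p : PA q, chi (mkT q δ (p' ⊗ₜ[ℂ] p)) =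
      TensorProduct.map (LinearMap.mulLeft ℂ p') LinearMap.id (Dr q δ p))
    (v : PA q) (x : PBP q δ) :
    chi (lact q δ v x) = TensorProduct.map (LinearMap.mulLeft ℂ v) LinearMap.id (chi x) := by
  obtain ⟨y, rfl⟩ := Submodule.mkQ_surjective _ x
  change chi (lact q δ v (mkT q δ y)) = TensorProduct.map _ _ (chi (mkT q δ y))
  induction y with
  | zero => simp
  | add a b ha hb => simp only [map_add, ha, hb]
  | tmul p' p =>
    have e : lact q δ v (mkT q δ (p' ⊗ₜ p)) = mkT q δ ((v * p') ⊗ₜ p) := by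
      simp [lact, mkT]
    rw [e, hchi, hchi]
    generalize Dr q δ p = s
    induction s with
    | zero => simp
    | add a b ha hb => simp only [map_add, ha, hb]
    | tmul u c => simp [mul_assoc]

lemma chi_both (δ : PA q →ₐ[ℂ] PA q ⊗[ℂ] AU q) (chi : PBP q δ →ₗ[ℂ] PA q ⊗[ℂ] Cq q)
    (hchi : ∀ p' p : PA q, chi (mkT q δ (p' ⊗ₜ[ℂ] p)) =
      TensorProduct.map (LinearMap.mulLeft ℂ p') LinearMap.id (Dr q δ p))
    (x : PBP q δ) (b : AU q) (hx : chi x = 1 ⊗ₜ[ℂ] rr q b)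
    (p v : PA q) (y : Fin 4 → PA q) (t : Fin 4 → AU q) (hv : δ v = ∑ j, y j ⊗ₜ[ℂ] t j) :
    chi (lact q δ p (ract q δ v x)) = ∑ j, (p * y j) ⊗ₜ[ℂ] rr q (b * t j) := by
  rw [chi_lact δ chi hchi, chi_ract δ chi hchi, hx, hv, TensorProduct.tmul_sum, map_sum, map_sum]
  refine Finset.sum_congr rfl fun j _ => ?_
  simp [triMap]

variable (q)

theorem tau_step_k_down (q : ℝ) (hq0 : 0 < q) (hq1 : q < 1)
    [StarRing (AU q)] [StarModule ℂ (AU q)]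
    (S : AU q →ₗ[ℂ] AU q)
    (hSanti : ∀ x y : AU q, S (x * y) = S y * S x) (hS1 : S 1 = 1)
    (hSleft : ∀ i j : Fin 4, ∑ k : Fin 4, S (tt q i k) * tt q k j = if i = j then 1 else 0)
    (hSright : ∀ i j : Fin 4, ∑ k : Fin 4, tt q i k * S (tt q k j) = if i = j then 1 else 0)
    (hSD : S (Dq q) = dI q) (hSDi : S (dI q) = Dq q)
    (hstarT : ∀ i j : Fin 4, star (tt q i j) = S (tt q j i))
    (hstarD : star (Dq q) = dI q)
    [StarRing (PA q)] [StarModule ℂ (PA q)]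
    (hstarz : ∀ i : Fin 4, star (z q i) = zs q i)
    (δ : PA q →ₐ[ℂ] PA q ⊗[ℂ] AU q)
    (hδz : ∀ i : Fin 4, δ (z q i) = ∑ j : Fin 4, z q j ⊗ₜ[ℂ] tt q j i)
    (hδzs : ∀ i : Fin 4, δ (zs q i) = ∑ j : Fin 4, zs q j ⊗ₜ[ℂ] star (tt q j i))
    (chi : PBP q δ →ₗ[ℂ] PA q ⊗[ℂ] Cq q)
    (hchi : ∀ p' p : PA q, chi (mkT q δ (p' ⊗ₜ[ℂ] p)) =
      TensorProduct.map (LinearMap.mulLeft ℂ p') LinearMap.id (Dr q δ p))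
    (k : ℤ) (hk : k ≤ 0) (m n : ℕ) (x : PBP q δ)
    (hx : chi x = 1 ⊗ₜ[ℂ] rr q (bas q k m n))
        : chi (((q : ℂ) ^ 4) • lact q δ (z q 0) (ract q δ (star (z q 0)) x)
        + ((q : ℂ) ^ 2) • lact q δ (star (z q 1)) (ract q δ (z q 1) x)
        + ((q : ℂ) ^ (m + n)) • lact q δ (star (z q 2)) (ract q δ (z q 2) x)
        + ((q : ℂ) ^ (m + n)) • lact q δ (z q 3) (ract q δ (star (z q 3)) x))
      = 1 ⊗ₜ[ℂ] rr q (bas q (k - 1) m n) := by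
  have hq : (q : ℂ) ≠ 0 := by exact_mod_cast hq0.ne'
  obtain ⟨K, rfl⟩ : ∃ K : ℕ, k = -(K : ℤ) := ⟨(-k).toNat, by omega⟩
  have hb : bas q (-(K : ℤ)) m n = bb' q K m n := by
    rcases Nat.eq_zero_or_pos K with rfl | hK
    · simp [bas, bb']
    · rw [bas, if_neg (by omega)]; simp [bb']
  have hb' : bas q (-(K : ℤ) - 1) m n = bb' q K m n * tt q 1 1 := by
    rw [bas, if_neg (by omega)]
    have : (-(-(K : ℤ) - 1)).toNat = K + 1 := by omega
    rw [this, bb', pow_succ, mul_assoc _ _ (tt q 1 1)]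
  rw [hb] at hx
  rw [hb']
  have g := good_bb (q := q) K m n
  have e33 : (q : ℂ) ^ (m + n) • rr q (bb' q K m n * tt q 2 2) = rr q (bb' q K m n * tt q 1 1) := by
    have := rr_low g (i := 2) (j := 2) (by decide) (by decide) 1
    simp only [mul_one] at this
    rw [this, rr_33, bb_22, map_smul]
  have e43 : rr q (bb' q K m n * tt q 3 2) = (-(q : ℂ) ^ K) • rr q (bb' q K m n * tt q 0 1) := by
    have := rr_low g (i := 3) (j := 2) (by decide) (by decide) 1
    simp only [mul_one] at this
    rw [this, rr_43, bb_12, map_smul, neg_smul]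
  simp only [map_add, map_smul, hstarz]
  rw [chi_both δ chi hchi x _ hx (z q 0) (zs q 0) _ _ (hδzs 0),
    chi_both δ chi hchi x _ hx (zs q 1) (z q 1) _ _ (hδz 1),
    chi_both δ chi hchi x _ hx (zs q 2) (z q 2) _ _ (hδz 2),
    chi_both δ chi hchi x _ hx (z q 3) (zs q 3) _ _ (hδzs 3)]
  simp only [hstarT, rr_S1 hq S hSright, rr_S4 S hSright, Fin.sum_univ_four, Matrix.cons_val]
  rw [rr_off' g (i := 2) (j := 1) (Or.inr (by decide)),
    rr_off' g (i := 3) (j := 1) (Or.inr (by decide)),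
    rr_off' g (i := 0) (j := 2) (Or.inl (by decide)),
    rr_off' g (i := 1) (j := 2) (Or.inl (by decide))]
  simp only [map_zero, TensorProduct.tmul_zero, add_zero, zero_add, map_smul, e43,
    smul_add]
  have f3 : ∀ p : PA q, (q : ℂ) ^ (m + n) • (p ⊗ₜ[ℂ] rr q (bb' q K m n * tt q 2 2))
      = p ⊗ₜ[ℂ] rr q (bb' q K m n * tt q 1 1) := fun p => by
    rw [← TensorProduct.tmul_smul, e33]
  rw [f3, f3]
  have s1 := zs_z_self q 1
  have s2 := zs_z_self q 2
  have su := z_zs_sum q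
  have d1 : Finset.univ.filter (· < (1 : Fin 4)) = {0} := by decide
  have d2 : Finset.univ.filter (· < (2 : Fin 4)) = {0, 1} := by decide
  rw [d1, Finset.sum_singleton] at s1
  rw [d2, Finset.sum_pair (by decide)] at s2
  rw [Fin.sum_univ_four] at su
  rw [s1, s2, zs_z q (i := 0) (j := 1) (by decide), zs_z q (i := 3) (j := 2) (by decide), ← su]
  generalize rr q (bb' q K m n * tt q 1 1) = f
  generalize rr q (bb' q K m n * tt q 0 1) = e
  simp only [TensorProduct.add_tmul, ← TensorProduct.smul_tmul', TensorProduct.tmul_smul, smul_add, smul_smul]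
  match_scalars <;> (try field_simp) <;> ring


end QIB
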